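/- Let n ≥ 2 be an integer, p ≥ 1 a real number, σₙ = π^{n/2}/Γ(n/2+1), and Φ(t) = n ∫₀ᵗ (sinh s)^{n−1} ds with inverse Φ⁻¹. Let v : [0,∞) → [0,∞) be a continuously differentiable nonincreasing function which vanishes outside a bounded interval. For x in the open unit ball Bⁿ ⊂ ℝⁿ set ρ(x) = ln((1+|x|)/(1−|x|)) (the hyperbolic distance from x to 0) and u(x) = v(σₙ Φ(ρ(x))). Then ∫_{Bⁿ} ((1−|x|²)/2)^p |∇u(x)|^p (2/(1−|x|²))^n dx = (nσₙ)^p ∫₀^∞ |v'(s)|^p ( sinh Φ⁻¹(s/σₙ) )^{p(n−1)} ds. -/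

import Mathlib

open Real MeasureTheory

/-- Volume of the Euclidean unit ball in `ℝⁿ`. -/
noncomputable def unitBallVol (n : ℕ) : ℝ := π ^ ((n : ℝ) / 2) / Real.Gamma ((n : ℝ) / 2 + 1)

lemma unitBallVol_pos (n : ℕ) : 0 < unitBallVol n :=
  div_pos (rpow_pos_of_pos pi_pos _) (Gamma_pos_of_pos (by positivity))

lemma volume_real_unit_ball (n : ℕ) [NeZero n] :
    (volume : Measure (EuclideanSpace ℝ (Fin n))).real (Metric.ball 0 1) = unitBallVol n := by
  have h : √π ^ n = π ^ ((n : ℝ) / 2) := by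
    rw [sqrt_eq_rpow, ← rpow_natCast, ← rpow_mul pi_pos.le]
    congr 1
    ring
  have hpos := (unitBallVol_pos n).le
  rw [unitBallVol] at hpos ⊢
  rw [measureReal_def, EuclideanSpace.volume_ball, Fintype.card_fin, h]
  simp [ENNReal.toReal_ofReal hpos]

/-- The distance from the origin in the Poincaré ball model, as a function of the
Euclidean norm. -/
noncomputable def poincareDist (r : ℝ) : ℝ := log ((1 + r) / (1 - r))

lemma poincareDist_pos {r : ℝ} (hr : r ∈ Set.Ioo (0 : ℝ) 1) : 0 < poincareDist r := by
  have h : 0 < 1 - r := sub_pos.2 hr.2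
  exact log_pos ((one_lt_div h).2 (by linarith [hr.1]))

lemma sinh_poincareDist {r : ℝ} (hr : r ∈ Set.Ioo (0 : ℝ) 1) :
    sinh (poincareDist r) = r * (2 / (1 - r ^ 2)) := by
  have h1 : 0 < 1 - r := sub_pos.2 hr.2
  have h2 : 0 < 1 + r := by linarith [hr.1]
  have h3 : 1 - r ^ 2 ≠ 0 := by nlinarith
  rw [poincareDist, sinh_log (div_pos h2 h1)]
  field_simp
  ring

lemma hasDerivAt_poincareDist {r : ℝ} (hr : r ∈ Set.Ioo (0 : ℝ) 1) :
    HasDerivAt poincareDist (2 / (1 - r ^ 2)) r := by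
  have h1 : 0 < 1 - r := sub_pos.2 hr.2
  have h2 : 0 < 1 + r := by linarith [hr.1]
  have h3 : 1 - r ^ 2 ≠ 0 := by nlinarith
  have h := (((hasDerivAt_id r).const_add 1).div ((hasDerivAt_id r).const_sub 1) h1.ne').log
    (div_pos h2 h1).ne'
  refine h.congr_deriv ?_
  simp only [id, Pi.div_apply]
  field_simp
  ring

lemma injOn_poincareDist : Set.InjOn poincareDist (Set.Ioo 0 1) := by
  intro r hr s hs h
  have hr1 : 0 < 1 - r := sub_pos.2 hr.2
  have hs1 : 0 < 1 - s := sub_pos.2 hs.2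
  have h' := log_injOn_pos (div_pos (by linarith [hr.1]) hr1 : 0 < (1 + r) / (1 - r))
    (div_pos (by linarith [hs.1]) hs1 : 0 < (1 + s) / (1 - s)) h
  rw [div_eq_div_iff hr1.ne' hs1.ne'] at h'
  linarith

lemma exists_poincareDist_eq {t : ℝ} (ht : 0 < t) :
    ∃ r ∈ Set.Ioo (0 : ℝ) 1, poincareDist r = t := by
  have he : 1 < exp t := one_lt_exp_iff.2 ht
  refine ⟨(exp t - 1) / (exp t + 1), ⟨div_pos (by linarith) (by linarith), ?_⟩, ?_⟩
  · rw [div_lt_one (by linarith)]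
    linarith
  · rw [poincareDist]
    convert log_exp t using 2
    have h : exp t + 1 ≠ 0 := by linarith
    field_simp
    ring

lemma hasDerivAt_integral_sinh_pow (m : ℕ) (t : ℝ) :
    HasDerivAt (fun t ↦ ∫ s in (0 : ℝ)..t, sinh s ^ m) (sinh t ^ m) t :=
  (continuous_sinh.pow m).integral_hasStrictDerivAt 0 t |>.hasDerivAt

lemma integral_sinh_pow_pos (m : ℕ) {t : ℝ} (ht : 0 < t) :
    0 < ∫ s in (0 : ℝ)..t, sinh s ^ m :=
  intervalIntegral.intervalIntegral_pos_of_pos_on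
    ((continuous_sinh.pow m).intervalIntegrable _ _)
    (fun _ hx ↦ pow_pos (sinh_pos_iff.2 hx.1) m) ht

lemma integral_sinh_pow_neg (m : ℕ) (t : ℝ) :
    ∫ s in (0 : ℝ)..(-t), sinh s ^ m = (-1) ^ (m + 1) * ∫ s in (0 : ℝ)..t, sinh s ^ m := by
  have h := intervalIntegral.integral_comp_neg (a := 0) (b := t) fun s ↦ sinh s ^ m
  simp only [neg_zero, sinh_neg, neg_pow (sinh _), intervalIntegral.integral_const_mul] at h
  rw [intervalIntegral.integral_symm, ← h]
  ring

lemma exists_pos_integral_sinh_pow_eq (m : ℕ) {s t : ℝ} (hs : 0 < s)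
    (h : ∫ x in (0 : ℝ)..t, sinh x ^ m = s) :
    ∃ t' > 0, ∫ x in (0 : ℝ)..t', sinh x ^ m = s := by
  rcases lt_trichotomy t 0 with ht | rfl | ht
  · refine ⟨-t, neg_pos.2 ht, ?_⟩
    have hpos := integral_sinh_pow_pos m (neg_pos.2 ht)
    rw [integral_sinh_pow_neg, h] at hpos ⊢
    rcases neg_one_pow_eq_or ℝ (m + 1) with h' | h' <;> rw [h'] at hpos ⊢ <;> linarith
  · simp at h
    exact absurd h hs.ne
  · exact ⟨t, ht, h⟩

lemma norm_fderiv_comp_norm {E : Type*} [NormedAddCommGroup E] [InnerProductSpace ℝ E]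
    {u : E → ℝ} {w : ℝ → ℝ} {w' : ℝ} {x : E} (hx : x ≠ 0)
    (hu : u =ᶠ[nhds x] fun y ↦ w ‖y‖) (hw : HasDerivAt w w' ‖x‖) :
    ‖fderiv ℝ u x‖ = |w'| := by
  have : Nontrivial E := ⟨⟨x, 0, hx⟩⟩
  have hd : DifferentiableAt ℝ (‖·‖) x :=
    (contDiffAt_norm ℝ hx (n := 1)).differentiableAt one_ne_zero
  have h := (hw.comp_hasFDerivAt x hd.hasFDerivAt).congr_of_eventuallyEq hu
  rw [h.fderiv, norm_smul, norm_fderiv_norm hd, mul_one, norm_eq_abs]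

lemma setIntegral_ball_eq_of_radial {n : ℕ} [NeZero n] {F : EuclideanSpace ℝ (Fin n) → ℝ}
    {f : ℝ → ℝ} (h : ∀ x ≠ 0, ‖x‖ < 1 → F x = f ‖x‖) :
    ∫ x in Metric.ball (0 : EuclideanSpace ℝ (Fin n)) 1, F x =
      n * unitBallVol n * ∫ r in Set.Ioo (0 : ℝ) 1, r ^ (n - 1) * f r := by
  have h1 : ∫ x in Metric.ball (0 : EuclideanSpace ℝ (Fin n)) 1, F x =
      ∫ x : EuclideanSpace ℝ (Fin n), (Set.Iio 1).indicator f ‖x‖ := by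
    rw [← integral_indicator measurableSet_ball]
    refine integral_congr_ae ?_
    filter_upwards [Measure.ae_ne volume 0] with x hx
    by_cases hx1 : ‖x‖ < 1
    · simp [hx1, h x hx hx1]
    · simp [hx1]
  rw [h1, integral_fun_norm_addHaar, volume_real_unit_ball, finrank_euclideanSpace_fin,
    nsmul_eq_mul, smul_eq_mul, mul_assoc, ← Set.Ioi_inter_Iio,
    ← setIntegral_indicator measurableSet_Iio]
  congr! 4 with r
  by_cases hr : r < 1 <;> simp [hr]

/-- The hyperbolic Dirichlet energy of a radial function `u(x) = v(σₙ Φ(ρ(x)))` on the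
Poincaré ball equals the one-dimensional integral
`(nσₙ)^p ∫₀^∞ |v'(s)|^p (sinh Φ⁻¹(s/σₙ))^{p(n-1)} ds`. -/
theorem radial_energy_formula (n : ℕ) (hn : 2 ≤ n) (p : ℝ) (hp : 1 ≤ p)
    (Φ Φinv : ℝ → ℝ)
    (hΦ : ∀ t, Φ t = (n : ℝ) * ∫ s in (0:ℝ)..t, Real.sinh s ^ ((n : ℝ) - 1))
    (hinv : ∀ t, 0 ≤ t → Φinv (Φ t) = t)
    (hinv' : ∀ s, 0 ≤ s → Φ (Φinv s) = s)
    (v v' : ℝ → ℝ)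
    (hderiv : ∀ s ∈ Set.Ici (0:ℝ), HasDerivWithinAt v (v' s) (Set.Ici 0) s)
    (hcont : ContinuousOn v' (Set.Ici 0))
    (hmono : AntitoneOn v (Set.Ici 0))
    (hnonneg : ∀ s ∈ Set.Ici (0:ℝ), 0 ≤ v s)
    (hbdd : ∃ M : ℝ, ∀ s ≥ M, v s = 0)
    (u : EuclideanSpace ℝ (Fin n) → ℝ)
    (hu : ∀ x ∈ Metric.ball (0 : EuclideanSpace ℝ (Fin n)) 1,
      u x = v (unitBallVol n * Φ (Real.log ((1 + ‖x‖) / (1 - ‖x‖))))) :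
    ∫ x in Metric.ball (0 : EuclideanSpace ℝ (Fin n)) 1,
        ((1 - ‖x‖ ^ 2) / 2) ^ p * ‖fderiv ℝ u x‖ ^ p * (2 / (1 - ‖x‖ ^ 2)) ^ (n : ℝ)
      = ((n : ℝ) * unitBallVol n) ^ p *
        ∫ s in Set.Ioi (0:ℝ),
          |v' s| ^ p * Real.sinh (Φinv (s / unitBallVol n)) ^ (p * ((n : ℝ) - 1)) := by
  obtain ⟨m, rfl⟩ : ∃ m, n = m + 1 := ⟨n - 1, by omega⟩
  have hcast : ((m + 1 : ℕ) : ℝ) - 1 = m := by push_cast; ring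
  simp only [hcast, rpow_natCast] at hΦ ⊢
  set N : ℝ := ((m + 1 : ℕ) : ℝ) with hN
  have hN0 : 0 < N := by positivity
  set σ := unitBallVol (m + 1)
  have hσ : 0 < σ := unitBallVol_pos _
  set G : ℝ → ℝ := fun r ↦ σ * Φ (poincareDist r) with hG
  set G' : ℝ → ℝ := fun r ↦ N * σ * (sinh (poincareDist r) ^ m * (2 / (1 - r ^ 2))) with hG'
  have hw : ∀ r ∈ Set.Ioo (0 : ℝ) 1, 0 < 2 / (1 - r ^ 2) := fun r hr ↦
    div_pos two_pos (by nlinarith [hr.1, hr.2])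
  have hS : ∀ r ∈ Set.Ioo (0 : ℝ) 1, 0 < sinh (poincareDist r) := fun r hr ↦
    sinh_pos_iff.2 (poincareDist_pos hr)
  have hG'pos : ∀ r ∈ Set.Ioo (0 : ℝ) 1, 0 < G' r := fun r hr ↦ by
    have := hw r hr
    have := hS r hr
    positivity
  have hGpos : ∀ r ∈ Set.Ioo (0 : ℝ) 1, 0 < G r := fun r hr ↦ by
    have := integral_sinh_pow_pos m (poincareDist_pos hr)
    simp only [hG, hΦ]
    positivity
  have hGderiv : ∀ r ∈ Set.Ioo (0 : ℝ) 1, HasDerivAt G (G' r) r := fun r hr ↦ by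
    have h := (((hasDerivAt_integral_sinh_pow m (poincareDist r)).comp r
      (hasDerivAt_poincareDist hr)).const_mul N).const_mul σ
    simp only [hG, hΦ]
    refine h.congr_deriv ?_
    simp only [hG']
    ring
  have hGinj : Set.InjOn G (Set.Ioo 0 1) := fun r hr s hs h ↦ by
    refine injOn_poincareDist hr hs ?_
    rw [← hinv _ (poincareDist_pos hr).le, mul_left_cancel₀ hσ.ne' h,
      hinv _ (poincareDist_pos hs).le]
  have hGimage : G '' Set.Ioo 0 1 = Set.Ioi 0 := by
    refine Set.Subset.antisymm (Set.image_subset_iff.2 hGpos) fun s hs ↦ ?_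
    have hs : 0 < s := hs
    have h := hinv' (s / σ) (by positivity)
    rw [hΦ] at h
    obtain ⟨t, ht, hts⟩ := exists_pos_integral_sinh_pow_eq m (s := s / σ / N) (by positivity)
      ((eq_div_iff hN0.ne').2 ((mul_comm _ _).trans h))
    obtain ⟨r, hr, rfl⟩ := exists_poincareDist_eq ht
    refine ⟨r, hr, ?_⟩
    simp only [hG, hΦ, hts]
    field_simp
  have hgrad : ∀ x : EuclideanSpace ℝ (Fin (m + 1)), x ≠ 0 → ‖x‖ < 1 →
      ‖fderiv ℝ u x‖ = |v' (G ‖x‖)| * G' ‖x‖ := fun x hx hx1 ↦ by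
    have hr : ‖x‖ ∈ Set.Ioo (0 : ℝ) 1 := ⟨norm_pos_iff.2 hx, hx1⟩
    have hv := (hderiv _ (hGpos _ hr).le).hasDerivAt (Ici_mem_nhds (hGpos _ hr))
    have hux : u =ᶠ[nhds x] fun y ↦ (v ∘ G) ‖y‖ := by
      filter_upwards [Metric.isOpen_ball.mem_nhds (mem_ball_zero_iff.2 hx1)] with y hy
      exact hu y hy
    rw [norm_fderiv_comp_norm hx hux (hv.comp _ (hGderiv _ hr)), abs_mul,
      abs_of_pos (hG'pos _ hr)]
  rw [setIntegral_ball_eq_of_radial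
      (f := fun r ↦ ((1 - r ^ 2) / 2) ^ p * (|v' (G r)| * G' r) ^ p * (2 / (1 - r ^ 2)) ^ (m + 1))
      (fun x hx hx1 ↦ by rw [hgrad x hx hx1]),
    ← hGimage,
    integral_image_eq_integral_abs_deriv_smul measurableSet_Ioo
      (fun r hr ↦ (hGderiv r hr).hasDerivWithinAt) hGinj,
    ← integral_const_mul, ← integral_const_mul]
  refine setIntegral_congr_fun measurableSet_Ioo fun r hr ↦ ?_
  have hw0 := hw r hr
  have hS0 := hS r hr
  have hinvw : (1 - r ^ 2) / 2 = (2 / (1 - r ^ 2))⁻¹ := (inv_div _ _).symm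
  have hΦinv : Φinv (G r / σ) = poincareDist r := by
    rw [hG, mul_div_cancel_left₀ _ hσ.ne', hinv _ (poincareDist_pos hr).le]
  simp only [Nat.add_sub_cancel]
  rw [hΦinv, abs_of_pos (hG'pos r hr), hinvw, mul_comm p, rpow_mul hS0.le, rpow_natCast]
  have hsinh := sinh_poincareDist hr
  simp only [hG', smul_eq_mul]
  set w := 2 / (1 - r ^ 2)
  set S := sinh (poincareDist r)
  rw [mul_rpow (abs_nonneg _) (by positivity), mul_rpow (x := N * σ) (by positivity)
    (by positivity), mul_rpow (x := S ^ m) (by positivity) hw0.le, inv_rpow hw0.le]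
  have hwp : (w ^ p)⁻¹ * w ^ p = 1 := inv_mul_cancel₀ (rpow_pos_of_pos hw0 p).ne'
  have hSm : S ^ m = r ^ m * w ^ m := by rw [hsinh, mul_pow]
  calc _ = N * σ * (N * σ) ^ p * |v' (G r)| ^ p * (S ^ m) ^ p * (r ^ m * w ^ m) * w *
        ((w ^ p)⁻¹ * w ^ p) := by ring
    _ = _ := by rw [hwp, ← hSm]; ring
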